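/- arXiv:1702.02937 — 3 statements merged into one kernel-verified Lean document; each statement's English description precedes it below -/
import Mathlib

section
/- Let p(y,z) = a·y·z + b·y + c·z + d be a bivariate multilinear polynomial with nonnegative real coefficients satisfying b·c ≤ a·d. Then for every α with 0 ≤ α ≤ 1, we have a + d ≥ (1-α)^(1-α) · inf_{y,z > 0} (a·y·z + b·y + c·z + d)/((y·z/α)^α). -/
/-- The weighted AM-GM inequality in the form in which it bounds the value of the quotient at its
critical point. -/
lemma rpow_mul_div_sq_le {a d α : ℝ} (ha : 0 < a) (hd : 0 < d) (hα0 : 0 < α) (hα1 : α < 1) :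
    (1 - α) ^ (1 - α) * (d / (1 - α) ^ 2) ≤ (a + d) * (α * d / ((1 - α) ^ 2 * a)) ^ α := by
  obtain ⟨β, hβ⟩ : ∃ β, β = 1 - α := ⟨_, rfl⟩
  rw [← hβ]
  have hβ0 : 0 < β := by linarith
  have amgm := Real.geom_mean_le_arith_mean2_weighted hα0.le hβ0.le
    (div_pos ha hα0).le (div_pos hd hβ0).le (by linarith)
  rw [mul_div_cancel₀ _ hα0.ne', mul_div_cancel₀ _ hβ0.ne'] at amgm
  have key : (a / α) ^ α * (d / β) ^ β * (α * d / (β ^ 2 * a)) ^ α = β ^ β * (d / β ^ 2) := by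
    calc (a / α) ^ α * (d / β) ^ β * (α * d / (β ^ 2 * a)) ^ α
        = ((a / α) * (α * d / (β ^ 2 * a))) ^ α * (d / β) ^ β := by
          rw [Real.mul_rpow (by positivity) (by positivity)]; ring
      _ = (d / β ^ 2) ^ α * (β * (d / β ^ 2)) ^ β := by
          congr 2 <;> field_simp
      _ = β ^ β * ((d / β ^ 2) ^ α * (d / β ^ 2) ^ β) := by
          rw [Real.mul_rpow (by positivity) (by positivity)]; ring
      _ = β ^ β * (d / β ^ 2) := by
          rw [← Real.rpow_add (by positivity), hβ, add_sub_cancel, Real.rpow_one]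
  rw [← key]
  gcongr

lemma exists_pos_quotient_le_of_pos {a b c d α : ℝ}
    (ha : 0 < a) (hb : 0 < b) (hc : 0 < c) (hd : 0 < d)
    (hbc : b * c ≤ a * d) (hα0 : 0 < α) (hα1 : α < 1) :
    ∃ y z : ℝ, 0 < y ∧ 0 < z ∧
      (1 - α) ^ (1 - α) * ((a * y * z + b * y + c * z + d) / ((y * z / α) ^ α)) ≤ a + d := by
  have hβ0 : 0 < 1 - α := by linarith
  have amgm := rpow_mul_div_sq_le ha hd hα0 hα1
  obtain ⟨r, hr, rfl⟩ : ∃ r, 0 < r ∧ r ^ 2 = a := ⟨√a, Real.sqrt_pos.2 ha, Real.sq_sqrt ha.le⟩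
  obtain ⟨u, hu, rfl⟩ : ∃ r, 0 < r ∧ r ^ 2 = b := ⟨√b, Real.sqrt_pos.2 hb, Real.sq_sqrt hb.le⟩
  obtain ⟨v, hv, rfl⟩ : ∃ r, 0 < r ∧ r ^ 2 = c := ⟨√c, Real.sqrt_pos.2 hc, Real.sq_sqrt hc.le⟩
  obtain ⟨s, hs, rfl⟩ : ∃ r, 0 < r ∧ r ^ 2 = d := ⟨√d, Real.sqrt_pos.2 hd, Real.sq_sqrt hd.le⟩
  have huv : u * v ≤ r * s := by
    refine (sq_le_sq₀ (by positivity) (by positivity)).1 ?_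
    rwa [mul_pow, mul_pow]
  refine ⟨v / u * (α / (1 - α) * s / r), u / v * (α / (1 - α) * s / r),
    by positivity, by positivity, ?_⟩
  have hyz : v / u * (α / (1 - α) * s / r) * (u / v * (α / (1 - α) * s / r)) / α
      = α * s ^ 2 / ((1 - α) ^ 2 * r ^ 2) := by
    field_simp
  have hnum : r ^ 2 * (v / u * (α / (1 - α) * s / r)) * (u / v * (α / (1 - α) * s / r))
      + u ^ 2 * (v / u * (α / (1 - α) * s / r)) + v ^ 2 * (u / v * (α / (1 - α) * s / r)) + s ^ 2
      ≤ s ^ 2 / (1 - α) ^ 2 := by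
    calc _ = (α / (1 - α) * s) ^ 2 + 2 * ((u * v) * (α / (1 - α) * s / r)) + s ^ 2 := by
          field_simp; ring
      _ ≤ (α / (1 - α) * s) ^ 2 + 2 * ((r * s) * (α / (1 - α) * s / r)) + s ^ 2 := by
          gcongr
      _ = s ^ 2 / (1 - α) ^ 2 := by field_simp; ring
  rw [hyz, ← mul_div_assoc, div_le_iff₀ (by positivity)]
  exact (mul_le_mul_of_nonneg_left hnum (by positivity)).trans amgm

lemma exists_pos_quotient_le_add {a b c d α ε : ℝ}
    (ha : 0 ≤ a) (hb : 0 ≤ b) (hc : 0 ≤ c) (hd : 0 ≤ d)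
    (hbc : b * c ≤ a * d) (hα0 : 0 ≤ α) (hα1 : α ≤ 1) (hε : 0 < ε) :
    ∃ y z : ℝ, 0 < y ∧ 0 < z ∧
      (1 - α) ^ (1 - α) * ((a * y * z + b * y + c * z + d) / ((y * z / α) ^ α)) ≤ a + d + ε := by
  have small : ∀ K : ℝ, 0 ≤ K → ∀ δ : ℝ, 0 < δ → ∃ s : ℝ, 0 < s ∧ s ≤ 1 ∧ (K + 1) * s ≤ δ := by
    intro K hK δ hδ
    refine ⟨min 1 (δ / (K + 1)), by positivity, min_le_left _ _, ?_⟩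
    rw [← le_div_iff₀' (by positivity)]
    exact min_le_right _ _
  rcases hα0.eq_or_lt with rfl | hα0
  · obtain ⟨s, hs, hs1, hsε⟩ := small (b + c) (by positivity) ε hε
    refine ⟨s, s, hs, hs, ?_⟩
    simp only [sub_zero, Real.rpow_one, one_mul, Real.rpow_zero, div_one]
    have : a * s * s ≤ a := by
      rw [mul_assoc]
      exact mul_le_of_le_one_right ha (mul_le_one₀ hs1 hs.le hs1)
    linarith
  rcases hα1.eq_or_lt with rfl | hα1
  · obtain ⟨s, hs, hs1, hsε⟩ := small (b + c) (by positivity) ε hε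
    refine ⟨s⁻¹, s⁻¹, by positivity, by positivity, ?_⟩
    simp only [sub_self, Real.rpow_zero, one_mul, div_one, Real.rpow_one]
    have h : (a * s⁻¹ * s⁻¹ + b * s⁻¹ + c * s⁻¹ + d) / (s⁻¹ * s⁻¹)
        = a + (b + c) * s + d * (s * s) := by
      field_simp; ring
    have : d * (s * s) ≤ d := mul_le_of_le_one_right hd (mul_le_one₀ hs1 hs.le hs1)
    rw [h]
    linarith
  obtain ⟨η, hη, hη1, hηε⟩ := small (b + c) (by positivity) ((ε / 2) ^ 2) (by positivity)
  obtain ⟨y, z, hy, hz, h⟩ := exists_pos_quotient_le_of_pos (a := a + ε / 2) (b := b + η)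
    (c := c + η) (d := d + ε / 2) (by positivity) (by positivity) (by positivity) (by positivity)
    (by nlinarith [mul_nonneg ha hε.le, mul_nonneg hd hε.le]) hα0 hα1
  refine ⟨y, z, hy, hz, le_trans ?_ (h.trans_eq (by ring))⟩
  have hβ0 : 0 < 1 - α := by linarith
  gcongr <;> linarith

theorem bivariate_multilinear_lower_bound (a b c d α : ℝ)
    (ha : 0 ≤ a) (hb : 0 ≤ b) (hc : 0 ≤ c) (hd : 0 ≤ d)
    (hbc : b * c ≤ a * d) (hα0 : 0 ≤ α) (hα1 : α ≤ 1) :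
    a + d ≥ (1 - α) ^ (1 - α) *
      ⨅ y : {y : ℝ // 0 < y}, ⨅ z : {z : ℝ // 0 < z},
        (a * (y : ℝ) * (z : ℝ) + b * (y : ℝ) + c * (z : ℝ) + d) /
          (((y : ℝ) * (z : ℝ) / α) ^ α) := by
  have hnonneg : ∀ y z : {x : ℝ // 0 < x},
      0 ≤ (a * (y : ℝ) * (z : ℝ) + b * (y : ℝ) + c * (z : ℝ) + d) /
          (((y : ℝ) * (z : ℝ) / α) ^ α) := by
    rintro ⟨y, hy⟩ ⟨z, hz⟩
    positivity
  refine le_of_forall_pos_le_add fun ε hε ↦ ?_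
  obtain ⟨y, z, hy, hz, h⟩ := exists_pos_quotient_le_add ha hb hc hd hbc hα0 hα1 hε
  refine le_trans (mul_le_mul_of_nonneg_left ?_ (Real.rpow_nonneg (by linarith) _)) h
  refine (ciInf_le ⟨0, ?_⟩ (⟨y, hy⟩ : {y : ℝ // 0 < y})).trans
    (ciInf_le ⟨0, ?_⟩ (⟨z, hz⟩ : {z : ℝ // 0 < z}))
  · rintro _ ⟨y, rfl⟩
    exact Real.iInf_nonneg fun z ↦ hnonneg y z
  · rintro _ ⟨z, rfl⟩
    exact hnonneg ⟨y, hy⟩ z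
end

section
/- Let A ∈ ℝ^{n×n} be a doubly stochastic matrix (nonnegative entries, all row and column sums equal 1), and define Ã by Ã_{ij} = A_{ij}(1 - A_{ij}). Then the permanent of Ã satisfies per(Ã) ≥ ∏_{i,j} (1 - A_{ij}). -/
open Finset

theorem edge_bound_of_pos {α w a b c d L : ℝ} (hα : 0 < α) (hα1 : α < 1) (hw : 0 < w)
    (ha : 0 < a) (hb : 0 < b) (hc : 0 < c) (hd : 0 < d) (hadbc : a * d ≤ b * c)
    (h : ∀ x z : ℝ, 0 < x → 0 < z → L * (x * z) ^ α ≤ c + w * x * d + z * a + w * x * z * b) :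
    L * (α ^ α * (1 - α) ^ (1 - α)) ≤ c + w * b := by
  have hβ : 0 < 1 - α := by linarith
  set q := α / (1 - α) * c with hq
  have hq0 : 0 < q := by positivity
  set t := q ^ 2 / (b * c) with ht
  have ht0 : 0 < t := by positivity
  set σ := √t with hσ
  have hσ0 : 0 < σ := Real.sqrt_pos.2 ht0
  have hσ2 : σ ^ 2 = t := Real.sq_sqrt ht0.le
  set ρ := √(a / d) with hρ
  have hρ0 : 0 < ρ := Real.sqrt_pos.2 (by positivity)
  have hρ2 : ρ ^ 2 * d = a := by
    rw [hρ, Real.sq_sqrt (by positivity)]; field_simp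
  have key := h (ρ * σ / w) (σ / ρ) (by positivity) (by positivity)
  have e1 : ρ * σ / w * (σ / ρ) = t / w := by rw [← hσ2]; field_simp
  have e2 : w * (ρ * σ / w) * d = d * ρ * σ := by field_simp
  have e3 : σ / ρ * a = d * ρ * σ := by rw [← hρ2]; field_simp
  have e4 : w * (ρ * σ / w) * (σ / ρ) * b = t * b := by rw [← hσ2]; field_simp
  rw [e1, e2, e3, e4] at key
  have e5 : d * ρ * σ ≤ q := by
    refine le_of_sq_le_sq ?_ hq0.le
    calc (d * ρ * σ) ^ 2 = a * d * t := by rw [← hσ2, ← hρ2]; ring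
      _ ≤ b * c * t := by gcongr
      _ = q ^ 2 := by rw [ht]; field_simp
  have e6 : c + 2 * q + t * b = c / (1 - α) ^ 2 := by
    rw [ht, hq]; field_simp; ring
  have key2 : L * (t / w) ^ α ≤ c / (1 - α) ^ 2 := by linarith
  have amgm := Real.geom_mean_le_arith_mean2_weighted hα.le hβ.le
    (p₁ := w * b / α) (p₂ := c / (1 - α)) (by positivity) (by positivity) (by ring)
  have e7 : α * (w * b / α) + (1 - α) * (c / (1 - α)) = c + w * b := by field_simp; ring
  rw [e7] at amgm
  refine le_trans ?_ amgm
  have hp : 0 < (t / w) ^ α := by positivity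
  refine le_of_mul_le_mul_right ?_ hp
  calc L * (α ^ α * (1 - α) ^ (1 - α)) * (t / w) ^ α
      = L * (t / w) ^ α * (α ^ α * (1 - α) ^ (1 - α)) := by ring
    _ ≤ c / (1 - α) ^ 2 * (α ^ α * (1 - α) ^ (1 - α)) := by gcongr
    _ = (w * b / α) ^ α * (c / (1 - α)) ^ (1 - α) * (t / w) ^ α := by
      have et : t / w = α ^ 2 * c / ((1 - α) ^ 2 * (w * b)) := by
        rw [ht, hq]; field_simp
      rw [et]
      apply Real.log_injOn_pos (Set.mem_Ioi.2 (by positivity)) (Set.mem_Ioi.2 (by positivity))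
      have l1 : ∀ x y : ℝ, 0 < x → 0 < y → Real.log (x * y) = Real.log x + Real.log y :=
        fun x y hx hy => Real.log_mul hx.ne' hy.ne'
      have l2 : ∀ x y : ℝ, 0 < x → 0 < y → Real.log (x / y) = Real.log x - Real.log y :=
        fun x y hx hy => Real.log_div hx.ne' hy.ne'
      have l3 : ∀ x y : ℝ, 0 < x → Real.log (x ^ y) = y * Real.log x :=
        fun x y hx => Real.log_rpow hx y
      simp (disch := positivity) only [l1, l2, l3, Real.log_pow]
      push_cast
      ring

/-- A positively correlated bivariate polynomial that dominates a multiple of `(x * z) ^ α` has a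
large diagonal part. -/
theorem edge_bound {α w a b c d L : ℝ} (hα : 0 ≤ α) (hα1 : α < 1) (hw : w = α * (1 - α))
    (ha : 0 ≤ a) (hb : 0 ≤ b) (hc : 0 ≤ c) (hd : 0 ≤ d) (hadbc : a * d ≤ b * c)
    (h : ∀ x z : ℝ, 0 < x → 0 < z → L * (x * z) ^ α ≤ c + w * x * d + z * a + w * x * z * b) :
    L * (α ^ α * (1 - α) ^ (1 - α)) ≤ c + w * b := by
  rcases hα.eq_or_lt with rfl | hα0
  · have hw0 : w = 0 := by simp [hw]
    subst hw0
    simp only [Real.rpow_zero, mul_one, zero_mul, add_zero, sub_zero, Real.one_rpow] at h ⊢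
    refine le_of_forall_pos_le_add fun ε hε => ?_
    have h1 := h 1 (ε / (a + 1)) one_pos (by positivity)
    have h2 : ε / (a + 1) * a ≤ ε := by
      rw [div_mul_eq_mul_div, div_le_iff₀ (by positivity)]; nlinarith
    linarith
  have hβ : 0 < 1 - α := by linarith
  have hw0 : 0 < w := by rw [hw]; positivity
  refine le_of_forall_pos_le_add fun ε hε => ?_
  obtain ⟨η, hη, hηε⟩ : ∃ η : ℝ, 0 < η ∧ η + w * η ≤ ε :=
    ⟨ε / (1 + w), by positivity, by apply le_of_eq; field_simp⟩
  obtain ⟨δ, hδ, hδ'⟩ : ∃ δ : ℝ, 0 < δ ∧ (a + δ) * (d + δ) ≤ (b + η) * (c + η) := by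
    have hlt : (a + 0) * (d + 0) < (b + η) * (c + η) := by nlinarith [mul_nonneg hb hη.le]
    have hcont : Continuous fun δ : ℝ => (a + δ) * (d + δ) := by fun_prop
    have hev := (hcont.tendsto 0).eventually_lt_const hlt
    obtain ⟨δ, h1, h2⟩ := ((hev.filter_mono nhdsWithin_le_nhds).and
      (self_mem_nhdsWithin (s := Set.Ioi (0 : ℝ)))).exists
    exact ⟨δ, h2, h1.le⟩
  have := edge_bound_of_pos (L := L) hα0 hα1 hw0 (a := a + δ) (b := b + η) (c := c + η) (d := d + δ)
    (by positivity) (by positivity) (by positivity) (by positivity) hδ' (fun x z hx hz => by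
      refine (h x z hx hz).trans ?_
      gcongr <;> linarith)
  linarith

section MonomerDimer

variable {ι κ : Type*} [DecidableEq κ]

/-- Adjoin the row vertex `i` to a bipartite graph: `i` is either left unmatched, with weight `r i`,
or matched to one of the available column vertices. -/
def addRow (B : ι → κ → ℝ) (r : ι → ℝ) (i : ι) (g : Finset κ → ℝ) (C : Finset κ) : ℝ :=
  r i * g C + ∑ j ∈ C, B i j * g (C.erase j)

theorem addRow_addRow (B : ι → κ → ℝ) (r : ι → ℝ) (i k : ι) (g : Finset κ → ℝ) (C : Finset κ) :
    addRow B r i (addRow B r k g) C = r i * r k * g C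
      + ∑ j ∈ C, (r i * B k j + r k * B i j) * g (C.erase j)
      + ∑ j ∈ C, ∑ l ∈ C.erase j, B i j * B k l * g ((C.erase j).erase l) := by
  simp only [addRow, mul_add, add_mul, sum_add_distrib, mul_sum]
  simp only [mul_assoc, mul_left_comm (r k)]
  ring

instance addRow_leftCommutative (B : ι → κ → ℝ) (r : ι → ℝ) : LeftCommutative (addRow B r) where
  left_comm i k g := by
    funext C
    rw [addRow_addRow, addRow_addRow, mul_comm (r i)]
    congr 1
    · congr 1
      exact sum_congr rfl fun j _ => by rw [add_comm]
    · rw [sum_comm' (t' := C) (s' := fun l => C.erase l) (by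
        intro x y; simp only [mem_erase]; tauto)]
      refine sum_congr rfl fun j _ => sum_congr rfl fun l _ => ?_
      rw [erase_right_comm, mul_comm (B i l)]

/-- The monomer-dimer partition function of the bipartite graph on the row vertices `R` and the
column vertices `C`, with edge weights `B` and weights `r`, `c` for unmatched vertices. -/
def monomerDimer (B : ι → κ → ℝ) (r : ι → ℝ) (c : κ → ℝ) (R : Finset ι) (C : Finset κ) : ℝ :=
  R.val.foldr (addRow B r) (fun C => ∏ j ∈ C, c j) C

variable (B : ι → κ → ℝ) (r : ι → ℝ) (c : κ → ℝ)

@[simp]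
theorem monomerDimer_empty (C : Finset κ) : monomerDimer B r c ∅ C = ∏ j ∈ C, c j := rfl

variable [DecidableEq ι]

theorem monomerDimer_insert {i : ι} {R : Finset ι} (hi : i ∉ R) (C : Finset κ) :
    monomerDimer B r c (insert i R) C = r i * monomerDimer B r c R C
      + ∑ j ∈ C, B i j * monomerDimer B r c R (C.erase j) := by
  simp only [monomerDimer, insert_val_of_notMem hi, Multiset.foldr_cons]
  rfl

theorem monomerDimer_row {i : ι} {R : Finset ι} (hi : i ∈ R) (C : Finset κ) :
    monomerDimer B r c R C = r i * monomerDimer B r c (R.erase i) C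
      + ∑ j ∈ C, B i j * monomerDimer B r c (R.erase i) (C.erase j) := by
  rw [← monomerDimer_insert B r c (notMem_erase i R), insert_erase hi]

theorem monomerDimer_col {v : κ} (R : Finset ι) {C : Finset κ} (hv : v ∈ C) :
    monomerDimer B r c R C = c v * monomerDimer B r c R (C.erase v)
      + ∑ i ∈ R, B i v * monomerDimer B r c (R.erase i) (C.erase v) := by
  induction R using Finset.induction_on generalizing C with
  | empty => simp [mul_prod_erase _ _ hv]
  | insert i R hi ih =>
    have h1 : ∑ j ∈ C, B i j * monomerDimer B r c R (C.erase j)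
        = B i v * monomerDimer B r c R (C.erase v)
          + ∑ j ∈ C.erase v, B i j * (c v * monomerDimer B r c R ((C.erase v).erase j)
            + ∑ k ∈ R, B k v * monomerDimer B r c (R.erase k) ((C.erase v).erase j)) := by
      rw [← add_sum_erase _ _ hv]
      congr 1
      refine sum_congr rfl fun j hj => ?_
      rw [ih (mem_erase.2 ⟨(ne_of_mem_erase hj).symm, hv⟩), erase_right_comm]
    have h2 : ∑ k ∈ R, B k v * monomerDimer B r c ((insert i R).erase k) (C.erase v)
        = ∑ k ∈ R, B k v * (r i * monomerDimer B r c (R.erase k) (C.erase v)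
          + ∑ j ∈ C.erase v, B i j * monomerDimer B r c (R.erase k) ((C.erase v).erase j)) := by
      refine sum_congr rfl fun k hk => ?_
      have hki : i ≠ k := fun h => hi (h ▸ hk)
      rw [erase_insert_of_ne hki, monomerDimer_insert _ _ _ (fun h => hi (mem_of_mem_erase h))]
    rw [monomerDimer_insert _ _ _ hi, monomerDimer_insert _ _ _ hi, sum_insert hi,
      erase_insert hi, h1, h2, ih hv]
    simp only [mul_add, sum_add_distrib, mul_sum]
    rw [sum_comm (s := R)]
    simp only [mul_left_comm]
    ring

variable {B r c}

theorem monomerDimer_nonneg (hB : ∀ i j, 0 ≤ B i j) (hr : ∀ i, 0 ≤ r i) (hc : ∀ j, 0 ≤ c j)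
    (R : Finset ι) (C : Finset κ) : 0 ≤ monomerDimer B r c R C := by
  induction R using Finset.induction_on generalizing C with
  | empty => exact prod_nonneg fun j _ => hc j
  | insert i R hi ih =>
    rw [monomerDimer_insert _ _ _ hi]
    exact add_nonneg (mul_nonneg (hr i) (ih C))
      (sum_nonneg fun j _ => mul_nonneg (hB i j) (ih _))

/-- Deleting a row vertex and deleting a column vertex are positively correlated. -/
theorem monomerDimer_erase_mul_erase_le (hB : ∀ i j, 0 ≤ B i j) (hr : ∀ i, 0 ≤ r i)
    (hc : ∀ j, 0 ≤ c j) {R : Finset ι} {C : Finset κ} {u : ι} {v : κ} (hu : u ∈ R) (hv : v ∈ C) :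
    monomerDimer B r c (R.erase u) C * monomerDimer B r c R (C.erase v) ≤
      monomerDimer B r c (R.erase u) (C.erase v) * monomerDimer B r c R C := by
  induction hk : R.card generalizing R C u v with
  | zero => simp_all
  | succ k IH =>
  have hcard : (R.erase u).card = k := by rw [card_erase_of_mem hu, hk]; rfl
  set H := R.erase u with hH
  have same : ∀ j ∈ C.erase v, monomerDimer B r c H C * monomerDimer B r c H ((C.erase v).erase j)
      ≤ monomerDimer B r c H (C.erase v) * monomerDimer B r c H (C.erase j) := by
    intro j hj
    have hjC := mem_of_mem_erase hj
    rw [monomerDimer_col B r c H hjC, monomerDimer_col B r c H hj, add_mul, add_mul, sum_mul,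
      sum_mul, erase_right_comm (a := v)]
    refine add_le_add (le_of_eq (by ring)) (sum_le_sum fun i hi => ?_)
    have := IH hi (mem_erase.2 ⟨(ne_of_mem_erase hj).symm, hv⟩ : v ∈ C.erase j) hcard
    nlinarith [mul_le_mul_of_nonneg_left this (hB i j)]
  rw [monomerDimer_row B r c hu C, monomerDimer_row B r c hu (C.erase v), mul_add, mul_add,
    ← add_sum_erase C _ hv, mul_add, mul_sum, mul_sum]
  have h0 : 0 ≤ monomerDimer B r c H (C.erase v) * (B u v * monomerDimer B r c H (C.erase v)) :=
    mul_nonneg (monomerDimer_nonneg hB hr hc _ _)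
      (mul_nonneg (hB u v) (monomerDimer_nonneg hB hr hc _ _))
  have h1 : ∑ j ∈ C.erase v,
        monomerDimer B r c H C * (B u j * monomerDimer B r c H ((C.erase v).erase j))
      ≤ ∑ j ∈ C.erase v,
        monomerDimer B r c H (C.erase v) * (B u j * monomerDimer B r c H (C.erase j)) :=
    sum_le_sum fun j hj => by nlinarith [mul_le_mul_of_nonneg_left (same j hj) (hB u j)]
  nlinarith

theorem monomerDimer_congr {B' : ι → κ → ℝ} {r' : ι → ℝ} {R : Finset ι}
    (hB : ∀ i ∈ R, B i = B' i) (hr : ∀ i ∈ R, r i = r' i) (C : Finset κ) :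
    monomerDimer B r c R C = monomerDimer B' r' c R C := by
  induction R using Finset.induction_on generalizing C with
  | empty => rfl
  | insert i R hi ih =>
    have ih' := ih (fun i h => hB i (mem_insert_of_mem h)) (fun i h => hr i (mem_insert_of_mem h))
    simp only [monomerDimer_insert _ _ _ hi, ih', hB i (mem_insert_self i R),
      hr i (mem_insert_self i R)]

theorem monomerDimer_add_row_weight {u : ι} {R : Finset ι} (hu : u ∈ R) (x : ℝ) (C : Finset κ) :
    monomerDimer B (r + Pi.single u x) c R C
      = monomerDimer B r c R C + x * monomerDimer B r c (R.erase u) C := by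
  have h : ∀ C, monomerDimer B (r + Pi.single u x) c (R.erase u) C
      = monomerDimer B r c (R.erase u) C := fun C =>
    monomerDimer_congr (fun _ _ => rfl) (fun i hi => by simp [ne_of_mem_erase hi]) C
  rw [monomerDimer_row _ _ _ hu, monomerDimer_row _ r _ hu]
  simp only [h, Pi.add_apply, Pi.single_eq_same]
  ring

theorem monomerDimer_add_col_weight {v : κ} (R : Finset ι) {C : Finset κ} (hv : v ∈ C) (z : ℝ) :
    monomerDimer B r (c + Pi.single v z) R C
      = monomerDimer B r c R C + z * monomerDimer B r c R (C.erase v) := by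
  have h : ∀ (R : Finset ι) (C : Finset κ), v ∉ C →
      monomerDimer B r (c + Pi.single v z) R C = monomerDimer B r c R C := by
    intro R
    induction R using Finset.induction_on with
    | empty =>
      intro C hC
      refine prod_congr rfl fun j hj => ?_
      have : j ≠ v := fun h => hC (h ▸ hj)
      simp [this]
    | insert i R hi ih =>
      intro C hC
      rw [monomerDimer_insert _ _ _ hi, monomerDimer_insert _ _ _ hi, ih C hC]
      congr 1
      exact sum_congr rfl fun j _ => by rw [ih _ fun h => hC (mem_of_mem_erase h)]
  rw [monomerDimer_col _ _ _ R hv, monomerDimer_col _ _ c R hv]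
  simp only [h _ _ (notMem_erase v C), Pi.add_apply, Pi.single_eq_same]
  ring

theorem monomerDimer_add_edge_weight {u : ι} {v : κ} {R : Finset ι} {C : Finset κ} (hu : u ∈ R)
    (hv : v ∈ C) (w : ℝ) :
    monomerDimer (B + Pi.single u (Pi.single v w)) r c R C
      = monomerDimer B r c R C + w * monomerDimer B r c (R.erase u) (C.erase v) := by
  have h : ∀ C, monomerDimer (B + Pi.single u (Pi.single v w)) r c (R.erase u) C
      = monomerDimer B r c (R.erase u) C := fun C =>
    monomerDimer_congr (fun i hi => by simp [ne_of_mem_erase hi]) (fun _ _ => rfl) C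
  rw [monomerDimer_row _ _ _ hu, monomerDimer_row B _ _ hu]
  simp only [h, Pi.add_apply, Pi.single_eq_same, add_mul, sum_add_distrib]
  rw [sum_eq_single v (f := fun j => Pi.single (M := fun _ => ℝ) v w j * _)
    (fun j _ hj => by simp [hj]) (fun h => absurd hv h)]
  simp only [Pi.single_eq_same]
  ring

theorem monomerDimer_zero_edge_weight (R : Finset ι) (C : Finset κ) :
    monomerDimer 0 r c R C = (∏ i ∈ R, r i) * ∏ j ∈ C, c j := by
  induction R using Finset.induction_on with
  | empty => simp
  | insert i R hi ih => rw [monomerDimer_insert _ _ _ hi, ih, prod_insert hi]; simp [mul_assoc]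

end MonomerDimer

theorem sum_perm_eq_monomerDimer {ι : Type*} [Fintype ι] [DecidableEq ι] (B : ι → ι → ℝ)
    (R : Finset ι) (τ : Equiv.Perm ι) :
    ∑ σ : Equiv.Perm ι with ∀ i ∉ R, σ i = τ i, ∏ i ∈ R, B i (σ i)
      = monomerDimer B 0 0 R (R.image τ) := by
  induction R using Finset.induction_on generalizing τ with
  | empty =>
    have : ({σ : Equiv.Perm ι | ∀ i ∉ (∅ : Finset ι), σ i = τ i} : Finset _) = {τ} := by
      ext σ; simp [Equiv.ext_iff]
    rw [this]; simp
  | insert i R hi ih =>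
    rw [monomerDimer_insert _ _ _ hi, Pi.zero_apply, zero_mul, zero_add]
    rw [← sum_fiberwise_of_maps_to (t := (insert i R).image τ) (g := fun σ => σ i)]
    · refine sum_congr rfl fun j hj => ?_
      set τ' : Equiv.Perm ι := τ * Equiv.swap i (τ⁻¹ j) with hτ'
      have hτ'i : τ' i = j := by simp [hτ']
      have hjR : τ⁻¹ j ∈ insert i R := by
        obtain ⟨k, hk, rfl⟩ := mem_image.1 hj
        simpa using hk
      have hout : ∀ k ∉ insert i R, τ' k = τ k := fun k hk => by
        have h1 : k ≠ i := fun h => hk (h ▸ mem_insert_self _ _)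
        have h2 : k ≠ τ⁻¹ j := fun h => hk (h ▸ hjR)
        simp only [hτ', Equiv.Perm.mul_apply, Equiv.swap_apply_of_ne_of_ne h1 h2]
      have himg : ((insert i R).image τ).erase j = R.image τ' := by
        have : (insert i R).image τ = (insert i R).image τ' := by
          have hs : (insert i R).image (Equiv.swap i (τ⁻¹ j)) = insert i R := by
            refine eq_of_subset_of_card_le ?_ ?_
            · intro k hk
              obtain ⟨l, hl, rfl⟩ := mem_image.1 hk
              rw [Equiv.swap_apply_def]
              split_ifs
              · exact hjR
              · exact mem_insert_self _ _
              · exact hl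
            · rw [card_image_of_injective _ (Equiv.injective _)]
          conv_lhs => rw [← hs]
          rw [image_image]; rfl
        rw [this, image_insert, hτ'i, erase_insert]
        intro h
        obtain ⟨k, hk, hkj⟩ := mem_image.1 h
        exact hi (τ'.injective (hkj.trans hτ'i.symm) ▸ hk)
      rw [himg, ← ih, mul_sum]
      refine sum_congr ?_ fun σ hσ => ?_
      · ext σ
        simp only [mem_filter, mem_univ, true_and]
        constructor
        · rintro ⟨h1, h2⟩ k hk
          by_cases hki : k = i
          · rw [hki, h2, hτ'i]
          · have : k ∉ insert i R := by simp [hki, hk]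
            rw [h1 k this, hout k this]
        · intro h
          refine ⟨fun k hk => ?_, (h i hi).trans hτ'i⟩
          rw [h k fun h => hk (mem_insert_of_mem h), hout k hk]
      · rw [prod_insert hi, (mem_filter.1 hσ).2 i hi, hτ'i]
    · intro σ hσ
      have hσ' := (mem_filter.1 hσ).2
      obtain ⟨k, hk⟩ := τ.surjective (σ i)
      refine mem_image.2 ⟨k, ?_, hk⟩
      by_contra hkR
      have := σ.injective ((hσ' k hkR).trans hk)
      exact hkR (this ▸ mem_insert_self _ _)

theorem sum_perm_eq_monomerDimer_univ {ι : Type*} [Fintype ι] [DecidableEq ι] (B : ι → ι → ℝ) :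
    ∑ σ : Equiv.Perm ι, ∏ i, B i (σ i) = monomerDimer B 0 0 univ univ := by
  simpa using sum_perm_eq_monomerDimer B univ 1

section CutEdges

variable {ι κ : Type*} [Fintype ι] [Fintype κ] [DecidableEq ι] [DecidableEq κ]

/-- The monomer-dimer partition function in which the edges in `D` are kept with their weight `w`,
while every other edge `e` is cut into two pendant half-edges, of weight `w e * x e` at its row
vertex and `z e` at its column vertex. -/
def cutPartition (w x z : ι × κ → ℝ) (D : Finset (ι × κ)) (R : Finset ι) (C : Finset κ) : ℝ :=
  monomerDimer (fun i j => if (i, j) ∈ D then w (i, j) else 0)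
    (fun i => ∑ j, if (i, j) ∈ D then 0 else w (i, j) * x (i, j))
    (fun j => ∑ i, if (i, j) ∈ D then 0 else z (i, j)) R C

variable (w : ι × κ → ℝ)

/-- Rejoining the half-edges of each `e ∈ D` costs a factor `α e ^ α e * (1 - α e) ^ (1 - α e)` in a
lower bound for the partition function by a monomial. -/
theorem cut_edges_bound {α : ι × κ → ℝ} (hα : ∀ e, 0 ≤ α e) (hα1 : ∀ e, α e < 1) {L : ℝ}
    (hw : ∀ e, w e = α e * (1 - α e))
    (h : ∀ x z : ι × κ → ℝ, (∀ e, 0 < x e) → (∀ e, 0 < z e) →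
      L * ∏ e, (x e * z e) ^ α e ≤ cutPartition w x z ∅ univ univ)
    (D : Finset (ι × κ)) (x z : ι × κ → ℝ) (hx : ∀ e, 0 < x e) (hz : ∀ e, 0 < z e) :
    L * (∏ e ∈ D, (α e ^ α e * (1 - α e) ^ (1 - α e))) * ∏ e ∈ Dᶜ, (x e * z e) ^ α e
      ≤ cutPartition w x z D univ univ := by
  have hw0 : ∀ e, 0 ≤ w e := fun e => by
    rw [hw]; exact mul_nonneg (hα e) (sub_nonneg.2 (hα1 e).le)
  induction D using Finset.induction_on generalizing x z with
  | empty => simpa using h x z hx hz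
  | insert e D he ih =>
    obtain ⟨u, v⟩ := e
    set e : ι × κ := (u, v) with hedef
    set B : ι → κ → ℝ := fun i j => if (i, j) ∈ D then w (i, j) else 0 with hB
    set r : ι → ℝ := fun i => ∑ j, if (i, j) ∈ insert e D then 0 else w (i, j) * x (i, j) with hr
    set c : κ → ℝ := fun j => ∑ i, if (i, j) ∈ insert e D then 0 else z (i, j) with hc
    have hB0 : ∀ i j, 0 ≤ B i j := fun i j => by
      simp only [hB]; split_ifs <;> simp [hw0]
    have hr0 : ∀ i, 0 ≤ r i := fun i => sum_nonneg fun j _ => by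
      split_ifs <;> simp [hw0, mul_nonneg, (hx _).le]
    have hc0 : ∀ j, 0 ≤ c j := fun j => sum_nonneg fun i _ => by
      split_ifs <;> simp [(hz _).le]
    have hnn := monomerDimer_nonneg hB0 hr0 hc0
    have hnew : cutPartition w x z (insert e D) univ univ = monomerDimer B r c univ univ
        + w e * monomerDimer B r c (univ.erase u) (univ.erase v) := by
      rw [← monomerDimer_add_edge_weight (mem_univ u) (mem_univ v)]
      unfold cutPartition
      congr 1
      funext i j
      by_cases hi : i = u
      · subst hi
        by_cases hj : j = v
        · subst hj
          have he' : (i, j) ∉ D := he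
          simp [hB, hedef, he']
        · simp [hB, hedef, hj]
      · simp [hB, hedef, hi]
    have hold : ∀ ξ ζ : ℝ, cutPartition w (Function.update x e ξ) (Function.update z e ζ) D univ univ
        = monomerDimer B r c univ univ + w e * ξ * monomerDimer B r c (univ.erase u) univ
          + ζ * monomerDimer B r c univ (univ.erase v)
          + w e * ξ * ζ * monomerDimer B r c (univ.erase u) (univ.erase v) := by
      intro ξ ζ
      have h1 : (fun i => ∑ j, if (i, j) ∈ D then 0 else w (i, j) * Function.update x e ξ (i, j))
          = r + Pi.single u (w e * ξ) := by
        funext i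
        by_cases hi : i = u
        · subst hi
          simp only [hr, Pi.add_apply, Pi.single_eq_same]
          rw [← add_sum_erase _ _ (mem_univ v), ← add_sum_erase _ _ (mem_univ v), add_comm]
          simp only [mem_insert, ← hedef, he, if_false, true_or, if_true, zero_add,
            Function.update_self]
          congr 1
          refine sum_congr rfl fun j hj => ?_
          have : (i, j) ≠ e := by simp [hedef, ne_of_mem_erase hj]
          simp [this]
        · simp [hr, hedef, hi]
      have h2 : (fun j => ∑ i, if (i, j) ∈ D then 0 else Function.update z e ζ (i, j))
          = c + Pi.single v ζ := by
        funext j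
        by_cases hj : j = v
        · subst hj
          simp only [hc, Pi.add_apply, Pi.single_eq_same]
          rw [← add_sum_erase _ _ (mem_univ u), ← add_sum_erase _ _ (mem_univ u), add_comm]
          simp only [mem_insert, ← hedef, he, if_false, true_or, if_true, zero_add,
            Function.update_self]
          congr 1
          refine sum_congr rfl fun i hi => ?_
          have : (i, j) ≠ e := by simp [hedef, ne_of_mem_erase hi]
          simp [this]
        · simp [hc, hedef, hj]
      unfold cutPartition
      rw [h1, h2, monomerDimer_add_row_weight (mem_univ u),
        monomerDimer_add_col_weight _ (mem_univ v), monomerDimer_add_col_weight _ (mem_univ v)]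
      ring
    have hcompl : Dᶜ = insert e (insert e D)ᶜ := by
      ext f; by_cases hf : f = e <;> simp [hf, he]
    rw [hnew, prod_insert he]
    refine le_trans (le_of_eq ?_) (edge_bound (α := α e) (w := w e)
      (L := L * (∏ e ∈ D, (α e ^ α e * (1 - α e) ^ (1 - α e)))
        * ∏ e ∈ (insert e D)ᶜ, (x e * z e) ^ α e) (hα e) (hα1 e) (hw e)
      (a := monomerDimer B r c univ (univ.erase v)) (d := monomerDimer B r c (univ.erase u) univ)
      (hnn _ _) (hnn _ _) (hnn _ _) (hnn _ _) ?_ ?_)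
    · ring
    · rw [mul_comm]
      exact monomerDimer_erase_mul_erase_le hB0 hr0 hc0 (mem_univ u) (mem_univ v)
    · intro ξ ζ hξ hζ
      have := ih (Function.update x e ξ) (Function.update z e ζ)
        (fun f => by by_cases hf : f = e <;> simp [hf, hξ, hx])
        (fun f => by by_cases hf : f = e <;> simp [hf, hζ, hz])
      rw [hold, hcompl, prod_insert (by simp)] at this
      simp only [Function.update_self] at this
      have hprod : ∏ f ∈ (insert e D)ᶜ,
          (Function.update x e ξ f * Function.update z e ζ f) ^ α f
          = ∏ f ∈ (insert e D)ᶜ, (x f * z f) ^ α f := by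
        refine prod_congr rfl fun f hf => ?_
        have hfe : f ≠ e := fun h => by simp [h] at hf
        simp [hfe]
      rw [hprod] at this
      refine le_trans (le_of_eq (by ring)) this

end CutEdges

theorem prod_div_rpow_le_sum {κ : Type*} [Fintype κ] {a y : κ → ℝ} (ha : ∀ j, 0 ≤ a j)
    (hsum : ∑ j, a j = 1) (hy : ∀ j, 0 < y j) : ∏ j, (y j / a j) ^ a j ≤ ∑ j, y j := by
  refine (Real.geom_mean_le_arith_mean_weighted univ a (fun j => y j / a j) (fun j _ => ha j) hsum
    (fun j _ => div_nonneg (hy j).le (ha j))).trans (sum_le_sum fun j _ => ?_)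
  rcases (ha j).eq_or_lt with h | h
  · simp [← h, (hy j).le]
  · exact (mul_div_cancel₀ _ h.ne').le

theorem schrijver_inequality (n : ℕ) (A : Matrix (Fin n) (Fin n) ℝ)
    (hnn : ∀ i j, 0 ≤ A i j)
    (hrow : ∀ i, ∑ j, A i j = 1) (hcol : ∀ j, ∑ i, A i j = 1) :
    ∑ σ : Equiv.Perm (Fin n), ∏ i, (A i (σ i) * (1 - A i (σ i)))
      ≥ ∏ i, ∏ j, (1 - A i j) := by
  have hle : ∀ i j, A i j ≤ 1 := fun i j =>
    hrow i ▸ single_le_sum (fun k _ => hnn i k) (mem_univ j)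
  by_cases hone : ∃ i j, A i j = 1
  · obtain ⟨i, j, hij⟩ := hone
    rw [ge_iff_le, prod_eq_zero (mem_univ i) (prod_eq_zero (mem_univ j) (by rw [hij, sub_self]))]
    exact sum_nonneg fun σ _ => prod_nonneg fun i _ =>
      mul_nonneg (hnn _ _) (sub_nonneg.2 (hle _ _))
  push Not at hone
  have hlt : ∀ i j, A i j < 1 := fun i j => lt_of_le_of_ne (hle i j) (hone i j)
  let α : Fin n × Fin n → ℝ := fun e => A e.1 e.2
  let w : Fin n × Fin n → ℝ := fun e => α e * (1 - α e)
  have hα : ∀ e, 0 ≤ α e := fun e => hnn _ _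
  have hα1 : ∀ e, α e < 1 := fun e => hlt _ _
  have hβ : ∀ e, 0 < 1 - α e := fun e => sub_pos.2 (hα1 e)
  have hstart : ∀ x z : Fin n × Fin n → ℝ, (∀ e, 0 < x e) → (∀ e, 0 < z e) →
      (∏ e, ((1 - α e) / α e) ^ α e) * ∏ e, (x e * z e) ^ α e
        ≤ cutPartition w x z ∅ univ univ := by
    intro x z hx hz
    have hcut : cutPartition w x z ∅ univ univ
        = (∏ i, ∑ j, w (i, j) * x (i, j)) * ∏ j, ∑ i, z (i, j) := by
      rw [← monomerDimer_zero_edge_weight]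
      simp only [cutPartition, notMem_empty, if_false]
      rfl
    have hrows : ∏ i, ∏ j, ((1 - α (i, j)) * x (i, j)) ^ α (i, j)
        ≤ ∏ i, ∑ j, w (i, j) * x (i, j) := by
      refine prod_le_prod (fun i _ => prod_nonneg fun j _ => Real.rpow_nonneg
        (mul_nonneg (hβ _).le (hx _).le) _) fun i _ => ?_
      refine (Real.geom_mean_le_arith_mean_weighted univ (fun j => α (i, j)) _
        (fun j _ => hα _) (hrow i) fun j _ => mul_nonneg (hβ _).le (hx _).le).trans_eq ?_
      exact sum_congr rfl fun j _ => by simp only [w]; ring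
    have hcols : ∏ j, ∏ i, (z (i, j) / α (i, j)) ^ α (i, j) ≤ ∏ j, ∑ i, z (i, j) :=
      prod_le_prod (fun j _ => prod_nonneg fun i _ => Real.rpow_nonneg
        (div_nonneg (hz _).le (hα _)) _) fun j _ =>
        prod_div_rpow_le_sum (fun i => hα (i, j)) (hcol j) fun i => hz (i, j)
    rw [hcut]
    refine le_trans (le_of_eq ?_) (mul_le_mul hrows hcols
      (prod_nonneg fun j _ => prod_nonneg fun i _ => Real.rpow_nonneg
        (div_nonneg (hz _).le (hα _)) _)
      (prod_nonneg fun i _ => sum_nonneg fun j _ =>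
        mul_nonneg (mul_nonneg (hα _) (hβ _).le) (hx _).le))
    rw [prod_comm (f := fun j i => (z (i, j) / α (i, j)) ^ α (i, j)), ← prod_mul_distrib,
      ← prod_mul_distrib, Fintype.prod_prod_type]
    refine prod_congr rfl fun i _ => ?_
    rw [← prod_mul_distrib]
    refine prod_congr rfl fun j _ => ?_
    rw [← Real.mul_rpow (div_nonneg (hβ _).le (hα _)) (mul_nonneg (hx _).le (hz _).le),
      ← Real.mul_rpow (mul_nonneg (hβ _).le (hx _).le) (div_nonneg (hz _).le (hα _))]
    congr 1
    ring
  have hmain := cut_edges_bound w hα hα1 (fun _ => rfl) hstart univ (fun _ => 1) (fun _ => 1)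
    (fun _ => one_pos) (fun _ => one_pos)
  have hend : cutPartition w (fun _ => 1) (fun _ => 1) univ univ univ
      = ∑ σ : Equiv.Perm (Fin n), ∏ i, (A i (σ i) * (1 - A i (σ i))) := by
    rw [sum_perm_eq_monomerDimer_univ (fun i j => A i j * (1 - A i j))]
    simp only [cutPartition, mem_univ, if_true, sum_const_zero]
    rfl
  rw [hend, compl_univ, prod_empty, mul_one, ← prod_mul_distrib, Fintype.prod_prod_type] at hmain
  refine le_trans (le_of_eq ?_) hmain
  refine prod_congr rfl fun i _ => prod_congr rfl fun j _ => ?_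
  change 1 - α (i, j) = _
  rcases (hα (i, j)).eq_or_lt with h | h
  · simp [← h]
  · rw [Real.div_rpow (hβ _).le h.le, ← mul_assoc, div_mul_cancel₀ _ (Real.rpow_pos_of_pos h _).ne',
      ← Real.rpow_add (hβ _), add_sub_cancel, Real.rpow_one]
end

section
/- Let p, q ∈ ℝ[z₁,...,zₙ] be polynomials with nonnegative coefficients, and for κ ∈ ℤ₊ⁿ let C_p(κ), C_q(κ) denote the coefficients of the monomial z^κ in p and q respectively. Then for every fixed y in the open positive orthant: sup over α ∈ ℝ₊ⁿ of inf over z > 0 of p(y)q(z)/∏ᵢ(yᵢzᵢ/αᵢ)^{αᵢ} is at least Σ_{κ ∈ ℤ₊ⁿ} κ^κ · C_p(κ) · C_q(κ), where κ^κ = ∏ᵢ κᵢ^{κᵢ} with 0⁰ = 1. -/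
theorem MvPolynomial.eval_nonneg_of_coeff_nonneg {σ : Type*} [Fintype σ] {p : MvPolynomial σ ℝ}
    (hp : ∀ κ, 0 ≤ p.coeff κ) {x : σ → ℝ} (hx : ∀ i, 0 ≤ x i) : 0 ≤ MvPolynomial.eval x p := by
  rw [MvPolynomial.eval_eq']
  exact Finset.sum_nonneg fun d _ =>
    mul_nonneg (hp d) (Finset.prod_nonneg fun i _ => pow_nonneg (hx i) _)

theorem MvPolynomial.sum_monomials_le_eval {σ : Type*} [Fintype σ] {p : MvPolynomial σ ℝ}
    (hp : ∀ κ, 0 ≤ p.coeff κ) {x : σ → ℝ} (hx : ∀ i, 0 ≤ x i) {s : Finset (σ →₀ ℕ)}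
    (hs : s ⊆ p.support) : ∑ κ ∈ s, p.coeff κ * ∏ i, x i ^ κ i ≤ MvPolynomial.eval x p := by
  rw [MvPolynomial.eval_eq']
  exact Finset.sum_le_sum_of_subset_of_nonneg hs fun d _ _ =>
    mul_nonneg (hp d) (Finset.prod_nonneg fun i _ => pow_nonneg (hx i) _)

theorem MvPolynomial.eval_const_le {σ : Type*} [Fintype σ] {q : MvPolynomial σ ℝ}
    (hq : ∀ κ, 0 ≤ q.coeff κ) {t : ℝ} (ht : 1 ≤ t) :
    MvPolynomial.eval (fun _ => t) q ≤ MvPolynomial.eval (fun _ => 1) q * t ^ q.totalDegree := by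
  rw [MvPolynomial.eval_eq', MvPolynomial.eval_eq', Finset.sum_mul]
  refine Finset.sum_le_sum fun d hd => ?_
  simp only [one_pow, Finset.prod_const_one, mul_one]
  refine mul_le_mul_of_nonneg_left ?_ (hq d)
  rw [Finset.prod_pow_eq_pow_sum]
  refine pow_le_pow_right₀ ht ?_
  have h := MvPolynomial.le_totalDegree hd
  rwa [Finsupp.sum_fintype _ _ fun _ => rfl] at h

theorem Real.div_self_rpow_pos {a b : ℝ} (ha : 0 ≤ a) (hb : 0 < b) : 0 < (b / a) ^ a := by
  rcases ha.eq_or_lt with rfl | h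
  · simp
  · exact Real.rpow_pos_of_pos (div_pos hb h) _

theorem Real.inv_div_self_rpow_le {a b D : ℝ} (ha : 0 ≤ a) (hb : 0 < b) (haD : a ≤ D) :
    ((b / a) ^ a)⁻¹ ≤ (1 + D / b) ^ D := by
  have hD : 0 ≤ D / b := div_nonneg (ha.trans haD) hb.le
  rw [← Real.inv_rpow (div_nonneg hb.le ha), inv_div]
  calc (a / b) ^ a ≤ (1 + D / b) ^ a := by
        refine Real.rpow_le_rpow (div_nonneg ha hb.le) ?_ ha
        have : a / b ≤ D / b := by gcongr
        linarith
    _ ≤ (1 + D / b) ^ D := Real.rpow_le_rpow_of_exponent_le (by linarith) haD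

theorem Real.prod_mul_const_div_rpow {ι : Type*} [Fintype ι] {y α : ι → ℝ}
    (hy : ∀ i, 0 < y i) (hα : ∀ i, 0 ≤ α i) {t : ℝ} (ht : 0 < t) :
    ∏ i, (y i * t / α i) ^ α i = (∏ i, (y i / α i) ^ α i) * t ^ ∑ i, α i := by
  rw [Real.rpow_sum_of_pos ht, ← Finset.prod_mul_distrib]
  refine Finset.prod_congr rfl fun i _ => ?_
  rw [← Real.mul_rpow (div_nonneg (hy i).le (hα i)) ht.le, div_mul_eq_mul_div]

/-- The ratio `p(y) q(z) / ∏ᵢ (yᵢ zᵢ / αᵢ) ^ αᵢ`, with the convention `0 ^ 0 = 1`. -/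
noncomputable def capacityRatio {ι : Type*} [Fintype ι] (p q : MvPolynomial ι ℝ)
    (y α z : ι → ℝ) : ℝ :=
  MvPolynomial.eval y p * MvPolynomial.eval z q / ∏ i, (y i * z i / α i) ^ α i

section capacityRatio

variable {ι : Type*} [Fintype ι] {p q : MvPolynomial ι ℝ} {y α z : ι → ℝ}

theorem capacityRatio_nonneg (hp : ∀ κ, 0 ≤ p.coeff κ) (hq : ∀ κ, 0 ≤ q.coeff κ)
    (hy : ∀ i, 0 < y i) (hα : ∀ i, 0 ≤ α i) (hz : ∀ i, 0 < z i) :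
    0 ≤ capacityRatio p q y α z :=
  div_nonneg
    (mul_nonneg (MvPolynomial.eval_nonneg_of_coeff_nonneg hp fun i => (hy i).le)
      (MvPolynomial.eval_nonneg_of_coeff_nonneg hq fun i => (hz i).le))
    (Finset.prod_nonneg fun i _ =>
      (Real.div_self_rpow_pos (hα i) (mul_pos (hy i) (hz i))).le)

theorem capacityRatio_bddBelow (hp : ∀ κ, 0 ≤ p.coeff κ) (hq : ∀ κ, 0 ≤ q.coeff κ)
    (hy : ∀ i, 0 < y i) (hα : ∀ i, 0 ≤ α i) :
    BddBelow (Set.range fun z : {z : ι → ℝ // ∀ i, 0 < z i} => capacityRatio p q y α z.val) :=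
  ⟨0, Set.forall_mem_range.2 fun z => capacityRatio_nonneg hp hq hy hα z.2⟩

theorem capacityRatio_const_le (hp : ∀ κ, 0 ≤ p.coeff κ) (hq : ∀ κ, 0 ≤ q.coeff κ)
    (hy : ∀ i, 0 < y i) (hα : ∀ i, 0 ≤ α i) {t : ℝ} (ht : 1 ≤ t) :
    capacityRatio p q y α (fun _ => t) ≤
      MvPolynomial.eval y p * MvPolynomial.eval (fun _ => 1) q * (∏ i, ((y i / α i) ^ α i)⁻¹) *
        t ^ (-(∑ i, α i - q.totalDegree)) := by
  have ht0 : 0 < t := one_pos.trans_le ht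
  have hP : 0 < ∏ i, (y i / α i) ^ α i :=
    Finset.prod_pos fun i _ => Real.div_self_rpow_pos (hα i) (hy i)
  have hpy := MvPolynomial.eval_nonneg_of_coeff_nonneg hp fun i => (hy i).le
  rw [capacityRatio, Real.prod_mul_const_div_rpow hy hα ht0, Finset.prod_inv_distrib, neg_sub,
    Real.rpow_sub ht0, Real.rpow_natCast]
  calc _ ≤ MvPolynomial.eval y p *
        (MvPolynomial.eval (fun _ => 1) q * t ^ q.totalDegree) /
          ((∏ i, (y i / α i) ^ α i) * t ^ ∑ i, α i) := by
        gcongr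
        exact MvPolynomial.eval_const_le hq ht
    _ = _ := by
        have := Real.rpow_pos_of_pos ht0 (∑ i, α i)
        field_simp

theorem iInf_capacityRatio_le (hp : ∀ κ, 0 ≤ p.coeff κ) (hq : ∀ κ, 0 ≤ q.coeff κ)
    (hy : ∀ i, 0 < y i) (hα : ∀ i, 0 ≤ α i) :
    ⨅ z : {z : ι → ℝ // ∀ i, 0 < z i}, capacityRatio p q y α z.val ≤
      MvPolynomial.eval y p * MvPolynomial.eval (fun _ => 1) q *
        ∏ i, (1 + q.totalDegree / y i) ^ (q.totalDegree : ℝ) := by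
  have hpq : 0 ≤ MvPolynomial.eval y p * MvPolynomial.eval (fun _ => 1) q :=
    mul_nonneg (MvPolynomial.eval_nonneg_of_coeff_nonneg hp fun i => (hy i).le)
      (MvPolynomial.eval_nonneg_of_coeff_nonneg hq fun _ => zero_le_one)
  have key : ∀ t : ℝ, 1 ≤ t → ⨅ z : {z : ι → ℝ // ∀ i, 0 < z i}, capacityRatio p q y α z.val ≤
      MvPolynomial.eval y p * MvPolynomial.eval (fun _ => 1) q * (∏ i, ((y i / α i) ^ α i)⁻¹) *
        t ^ (-(∑ i, α i - q.totalDegree)) := fun t ht =>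
    (ciInf_le (capacityRatio_bddBelow hp hq hy hα)
      ⟨fun _ => t, fun _ => one_pos.trans_le ht⟩).trans (capacityRatio_const_le hp hq hy hα ht)
  rcases le_or_gt (∑ i, α i) q.totalDegree with h | h
  · refine (key 1 le_rfl).trans ?_
    rw [Real.one_rpow, mul_one]
    refine mul_le_mul_of_nonneg_left (Finset.prod_le_prod (fun i _ =>
      (inv_pos.2 (Real.div_self_rpow_pos (hα i) (hy i))).le) fun i _ => ?_) hpq
    exact Real.inv_div_self_rpow_le (hα i) (hy i)
      ((Finset.single_le_sum (fun j _ => hα j) (Finset.mem_univ i)).trans h)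
  · have hlim := (tendsto_rpow_neg_atTop (sub_pos.2 h)).const_mul
      (MvPolynomial.eval y p * MvPolynomial.eval (fun _ => 1) q * ∏ i, ((y i / α i) ^ α i)⁻¹)
    rw [mul_zero] at hlim
    refine (ge_of_tendsto hlim (Filter.eventually_atTop.2 ⟨1, key⟩)).trans
      (mul_nonneg hpq (Finset.prod_nonneg fun i _ => Real.rpow_nonneg ?_ _))
    have := hy i
    positivity

theorem le_iInf_capacityRatio_natCast (hp : ∀ κ, 0 ≤ p.coeff κ) (hq : ∀ κ, 0 ≤ q.coeff κ)
    (hy : ∀ i, 0 < y i) {κ : ι →₀ ℕ} (hκ : κ ∈ q.support) :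
    MvPolynomial.eval y p * q.coeff κ * (∏ i, (κ i : ℝ) ^ κ i) / ∏ i, y i ^ κ i ≤
      ⨅ z : {z : ι → ℝ // ∀ i, 0 < z i}, capacityRatio p q y (fun i => (κ i : ℝ)) z.val := by
  have : Nonempty {z : ι → ℝ // ∀ i, 0 < z i} := ⟨⟨fun _ => 1, fun _ => one_pos⟩⟩
  refine le_ciInf fun ⟨z, hz⟩ => ?_
  have hY : 0 < ∏ i, y i ^ κ i := Finset.prod_pos fun i _ => pow_pos (hy i) _
  have hZ : 0 < ∏ i, z i ^ κ i := Finset.prod_pos fun i _ => pow_pos (hz i) _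
  have hK : 0 < ∏ i, (κ i : ℝ) ^ κ i := Finset.prod_pos fun i _ => by
    exact_mod_cast Nat.pow_self_pos
  have hpy := MvPolynomial.eval_nonneg_of_coeff_nonneg hp fun i => (hy i).le
  have hqz := MvPolynomial.sum_monomials_le_eval hq (fun i => (hz i).le)
    (Finset.singleton_subset_iff.2 hκ)
  rw [Finset.sum_singleton] at hqz
  simp only [capacityRatio, Real.rpow_natCast, div_pow, mul_pow, Finset.prod_div_distrib,
    Finset.prod_mul_distrib]
  calc _ = MvPolynomial.eval y p * (q.coeff κ * ∏ i, z i ^ κ i) /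
        ((∏ i, y i ^ κ i) * (∏ i, z i ^ κ i) / ∏ i, (κ i : ℝ) ^ κ i) := by
        field_simp
    _ ≤ _ := by gcongr

end capacityRatio

theorem sup_inf_ge_sum_kappa (n : ℕ) (p q : MvPolynomial (Fin n) ℝ)
    (hp : ∀ κ, 0 ≤ p.coeff κ) (hq : ∀ κ, 0 ≤ q.coeff κ)
    (y : Fin n → ℝ) (hy : ∀ i, 0 < y i) :
    (⨆ α : {α : Fin n → ℝ // ∀ i, 0 ≤ α i},
        ⨅ z : {z : Fin n → ℝ // ∀ i, 0 < z i},
          (MvPolynomial.eval y p * MvPolynomial.eval z.val q) /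
            ∏ i, (y i * z.val i / α.val i) ^ (α.val i))
      ≥ ∑ κ ∈ p.support ∩ q.support,
          (∏ i, (κ i : ℝ) ^ (κ i)) * p.coeff κ * q.coeff κ := by
  change _ ≤ ⨆ α : {α : Fin n → ℝ // ∀ i, 0 ≤ α i},
    ⨅ z : {z : Fin n → ℝ // ∀ i, 0 < z i}, capacityRatio p q y α.val z.val
  have hbdd : BddAbove (Set.range fun α : {α : Fin n → ℝ // ∀ i, 0 ≤ α i} =>
      ⨅ z : {z : Fin n → ℝ // ∀ i, 0 < z i}, capacityRatio p q y α.val z.val) :=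
    ⟨_, Set.forall_mem_range.2 fun α => iInf_capacityRatio_le hp hq hy α.2⟩
  set S := ⨆ α : {α : Fin n → ℝ // ∀ i, 0 ≤ α i},
    ⨅ z : {z : Fin n → ℝ // ∀ i, 0 < z i}, capacityRatio p q y α.val z.val
  have hS : 0 ≤ S := Real.iSup_nonneg fun α =>
    Real.iInf_nonneg fun z => capacityRatio_nonneg hp hq hy α.2 z.2
  have hle : ∀ κ ∈ q.support, MvPolynomial.eval y p * q.coeff κ * (∏ i, (κ i : ℝ) ^ κ i) ≤
      S * ∏ i, y i ^ κ i := fun κ hκ => by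
    rw [← div_le_iff₀ (Finset.prod_pos fun i _ => pow_pos (hy i) _)]
    exact (le_iInf_capacityRatio_natCast hp hq hy hκ).trans
      (le_ciSup hbdd ⟨fun i => (κ i : ℝ), fun i => Nat.cast_nonneg _⟩)
  have hsum := MvPolynomial.sum_monomials_le_eval hp (fun i => (hy i).le)
    (Finset.inter_subset_left : p.support ∩ q.support ⊆ p.support)
  rcases (p.support ∩ q.support).eq_empty_or_nonempty with h | h
  · rwa [h, Finset.sum_empty]
  have hpy : 0 < MvPolynomial.eval y p := by
    refine (Finset.sum_pos (fun κ hκ => mul_pos ((hp κ).lt_of_ne' ?_)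
      (Finset.prod_pos fun i _ => pow_pos (hy i) _)) h).trans_le hsum
    exact MvPolynomial.mem_support_iff.1 (Finset.mem_inter.1 hκ).1
  refine le_of_mul_le_mul_left ?_ hpy
  calc _ = ∑ κ ∈ p.support ∩ q.support,
        p.coeff κ * (MvPolynomial.eval y p * q.coeff κ * (∏ i, (κ i : ℝ) ^ κ i)) := by
        rw [Finset.mul_sum]
        exact Finset.sum_congr rfl fun κ _ => by ring
    _ ≤ ∑ κ ∈ p.support ∩ q.support, p.coeff κ * (S * ∏ i, y i ^ κ i) :=
        Finset.sum_le_sum fun κ hκ =>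
          mul_le_mul_of_nonneg_left (hle κ (Finset.mem_inter.1 hκ).2) (hp κ)
    _ = S * ∑ κ ∈ p.support ∩ q.support, p.coeff κ * ∏ i, y i ^ κ i := by
        rw [Finset.mul_sum]
        exact Finset.sum_congr rfl fun κ _ => by ring
    _ ≤ S * MvPolynomial.eval y p := mul_le_mul_of_nonneg_left hsum hS
    _ = _ := mul_comm _ _
end
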